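/- Under BiDCDFM(Z_r, Z_c, P, Θ_r, Θ_c), the K_r-th largest eigenvalue of ΩΩ' satisfies λ_{K_r}(ΩΩ') ≥ θ²_{r,min} θ²_{c,min} σ_{K_r}²(P) n_{r,min} n_{c,min}, where Ω = Θ_r Z_r P Z_c' Θ_c. -/

import Mathlib

open Matrix Finset MeasureTheory ProbabilityTheory Filter Asymptotics

noncomputable section

/-- The membership matrix associated with a label function `g`:
`memMat g i k = 1` if node `i` belongs to cluster `k`, and `0` otherwise. -/
def memMat {n K : ℕ} (g : Fin n → Fin K) : Matrix (Fin n) (Fin K) ℝ :=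
  fun i k => if g i = k then 1 else 0

/-- The number of nodes in cluster `k`. -/
def clusterSize {n K : ℕ} (g : Fin n → Fin K) (k : Fin K) : ℕ :=
  (Finset.univ.filter fun i => g i = k).card

/-- The minimum cluster size. -/
def minClusterSize {n K : ℕ} (g : Fin n → Fin K) : ℕ :=
  sInf (Set.range (clusterSize g))

/-- The maximum cluster size. -/
def maxClusterSize {n K : ℕ} (g : Fin n → Fin K) : ℕ :=
  sSup (Set.range (clusterSize g))

/-- Frobenius norm of a real matrix. -/
def frobNorm {m n : ℕ} (M : Matrix (Fin m) (Fin n) ℝ) : ℝ :=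
  Real.sqrt (∑ i, ∑ j, (M i j) ^ 2)

/-- Euclidean distance between rows `k` and `l` of a matrix. -/
def rowDist {K J : ℕ} (M : Matrix (Fin K) (Fin J) ℝ) (k l : Fin K) : ℝ :=
  Real.sqrt (∑ j, (M k j - M l j) ^ 2)

/-- Euclidean norm of row `k` of a matrix. -/
def rowNormF {K J : ℕ} (M : Matrix (Fin K) (Fin J) ℝ) (k : Fin K) : ℝ :=
  Real.sqrt (∑ j, (M k j) ^ 2)

/-- Euclidean norm of column `k` of a matrix. -/
def colNormF {m K : ℕ} (M : Matrix (Fin m) (Fin K) ℝ) (k : Fin K) : ℝ :=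
  Real.sqrt (∑ i, (M i k) ^ 2)

/-- Euclidean norm of a vector. -/
def vecNormF {n : ℕ} (v : Fin n → ℝ) : ℝ :=
  Real.sqrt (∑ i, (v i) ^ 2)

/-- Spectral norm (ℓ₂ operator norm) of a real matrix. -/
def specNorm {m n : ℕ} (M : Matrix (Fin m) (Fin n) ℝ) : ℝ :=
  sSup {c | ∃ x : Fin n → ℝ, (∑ j, (x j) ^ 2) ≤ 1 ∧
    c = Real.sqrt (∑ i, (M.mulVec x i) ^ 2)}

/-- The `k`-th largest value (1-indexed) among `f 0, …, f (n-1)`. -/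
def kthLargest {n : ℕ} (f : Fin n → ℝ) (k : ℕ) : ℝ :=
  ((Finset.univ.val.map f).sort (· ≤ ·)).getD (n - k) 0

/-- The `k`-th largest eigenvalue (1-indexed) of `M * Mᴴ` (`= M Mᵀ` over `ℝ`). -/
def kthEigMulSelf {m n : ℕ} (M : Matrix (Fin m) (Fin n) ℝ) (k : ℕ) : ℝ :=
  kthLargest (Matrix.isHermitian_mul_conjTranspose_self M).eigenvalues k

/-- The `k`-th largest singular value (1-indexed) of `M`. -/
def kthSingular {m n : ℕ} (M : Matrix (Fin m) (Fin n) ℝ) (k : ℕ) : ℝ :=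
  Real.sqrt (kthEigMulSelf M k)

/-- Row-normalized version of a matrix: each row is divided by its Euclidean norm. -/
def rowNormalize {m n : ℕ} (M : Matrix (Fin m) (Fin n) ℝ) : Matrix (Fin m) (Fin n) ℝ :=
  fun i j => M i j / Real.sqrt (∑ l, (M i l) ^ 2)

/-- `U`, `L`, `V` form the rank-`K` truncated singular value decomposition of `A`
corresponding to the `K` largest singular values: `U` and `V` have orthonormal columns,
`L` is diagonal carrying the `K` largest singular values of `A`, and the columns of `U`
(resp. `V`) are corresponding left (resp. right) singular vectors. -/
def IsTruncSVD {m n K : ℕ} (A : Matrix (Fin m) (Fin n) ℝ)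
    (U : Matrix (Fin m) (Fin K) ℝ) (L : Matrix (Fin K) (Fin K) ℝ)
    (V : Matrix (Fin n) (Fin K) ℝ) : Prop :=
  Uᵀ * U = 1 ∧ Vᵀ * V = 1 ∧ (∀ k l, k ≠ l → L k l = 0) ∧
    (∀ k : Fin K, L k k = kthSingular A (k.1 + 1)) ∧
    A * V = U * L ∧ Aᵀ * U = V * L

/-- `(g, X)` is a global minimizer of the K-means objective
`‖Z X - U‖_F²` over membership matrices `Z` (equivalently label functions `g'`)
and center matrices `X'`. -/
def IsKMeansFit {n K J : ℕ} (g : Fin n → Fin K) (X : Matrix (Fin K) (Fin J) ℝ)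
    (U : Matrix (Fin n) (Fin J) ℝ) : Prop :=
  ∀ (g' : Fin n → Fin K) (X' : Matrix (Fin K) (Fin J) ℝ),
    ∑ i, ∑ j, (U i j - X (g i) j) ^ 2 ≤ ∑ i, ∑ j, (U i j - X' (g' i) j) ^ 2

/-- The clustering error of estimated labels `ghat` w.r.t. true labels `g`:
`min_{π ∈ S_K} max_k (|C_k ∩ Ĉ_{π(k)}ᶜ| + |C_kᶜ ∩ Ĉ_{π(k)}|) / n_k`. -/
def clusterErr {n K : ℕ} (g ghat : Fin n → Fin K) : ℝ :=
  ⨅ π : Equiv.Perm (Fin K), ⨆ k : Fin K,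
    (((Finset.univ.filter fun i => g i = k ∧ ghat i ≠ π k).card : ℝ) +
      ((Finset.univ.filter fun i => g i ≠ k ∧ ghat i = π k).card : ℝ)) /
      (clusterSize g k : ℝ)

end

theorem aux_len {n : ℕ} (f : Fin n → ℝ) :
    ((Finset.univ.val.map f).sort (· ≤ ·)).length = n := by
  simp

theorem aux_kth_ge {n : ℕ} (f : Fin n → ℝ) (k : ℕ) (c : ℝ) (hk : 1 ≤ k) (hkn : k ≤ n)
    (h : k ≤ (Finset.univ.filter fun i => c ≤ f i).card) : c ≤ kthLargest f k := by
  unfold kthLargest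
  have hlen := aux_len f
  have hcount : ((Finset.univ.val.map f).sort (· ≤ ·)).countP (fun x => decide (c ≤ x))
      = (Finset.univ.filter fun i => c ≤ f i).card := by
    rw [← Multiset.coe_countP, Multiset.sort_eq, Multiset.countP_map]
    rfl
  have hs : ((Finset.univ.val.map f).sort (· ≤ ·)).Pairwise (· ≤ ·) :=
    Multiset.pairwise_sort _ _
  generalize (Finset.univ.val.map f).sort (· ≤ ·) = l at *
  by_contra hlt
  push Not at hlt
  have hlt' : n - k < l.length := by omega
  rw [List.getD_eq_getElem _ _ hlt'] at hlt
  rw [← hcount, ← List.take_append_drop (n - k + 1) l, List.countP_append] at h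
  have h0 : (l.take (n - k + 1)).countP (fun x => decide (c ≤ x)) = 0 := by
    rw [List.countP_eq_zero]
    intro a ha
    obtain ⟨j, hj, rfl⟩ := List.mem_iff_getElem.1 ha
    simp only [List.length_take] at hj
    rw [List.getElem_take]
    have hjl : j < l.length := by omega
    have : l[j] ≤ l[n-k] := by
      rcases Nat.lt_or_ge j (n-k) with h1 | h1
      · exact List.pairwise_iff_getElem.1 hs j (n-k) hjl hlt' h1
      · have : j = n - k := by omega
        subst this; exact le_rfl
    simp only [decide_eq_true_eq, not_le]
    linarith
  have h1 : (l.drop (n - k + 1)).countP (fun x => decide (c ≤ x)) ≤ k - 1 := by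
    refine List.countP_le_length.trans ?_
    simp; omega
  omega

theorem aux_kth_le {n : ℕ} (f : Fin n → ℝ) (i : Fin n) : kthLargest f n ≤ f i := by
  unfold kthLargest
  have hlen := aux_len f
  have hm : f i ∈ ((Finset.univ.val.map f).sort (· ≤ ·)) := by simp
  have hs : ((Finset.univ.val.map f).sort (· ≤ ·)).Pairwise (· ≤ ·) :=
    Multiset.pairwise_sort _ _
  generalize (Finset.univ.val.map f).sort (· ≤ ·) = l at *
  obtain ⟨j, hj, hji⟩ := List.mem_iff_getElem.1 hm
  have hlt' : n - n < l.length := by omega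
  rw [List.getD_eq_getElem _ _ hlt', ← hji]
  rcases Nat.eq_zero_or_pos j with h1 | h1
  · subst h1; simp
  · exact List.pairwise_iff_getElem.1 hs (n - n) j hlt' hj (by omega)

theorem aux_kth_mem {n : ℕ} (f : Fin n → ℝ) (hn : 0 < n) : ∃ i, kthLargest f n = f i := by
  unfold kthLargest
  have hlen := aux_len f
  have hm : ∀ a ∈ ((Finset.univ.val.map f).sort (· ≤ ·)), ∃ i, f i = a := by simp
  generalize (Finset.univ.val.map f).sort (· ≤ ·) = l at *
  have hlt' : n - n < l.length := by omega
  rw [List.getD_eq_getElem _ _ hlt']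
  obtain ⟨i, hi⟩ := hm _ (List.getElem_mem hlt')
  exact ⟨i, hi.symm⟩

theorem aux_spec {m n : ℕ} (M : Matrix (Fin m) (Fin n) ℝ) :
    ∃ Q : Matrix (Fin m) (Fin m) ℝ, (∀ v, ∑ i, (Q *ᵥ v) i ^ 2 = ∑ i, v i ^ 2) ∧
      ∀ v, ∑ j, (Mᵀ *ᵥ v) j ^ 2 =
        ∑ i, (Matrix.isHermitian_mul_conjTranspose_self M).eigenvalues i * (Q *ᵥ v) i ^ 2 := by
  set hA := Matrix.isHermitian_mul_conjTranspose_self M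
  have hsp := hA.spectral_theorem
  rw [Unitary.conjStarAlgAut_apply] at hsp
  have hU : (hA.eigenvectorUnitary : Matrix (Fin m) (Fin m) ℝ) *
      star (hA.eigenvectorUnitary : Matrix (Fin m) (Fin m) ℝ) = 1 :=
    Unitary.mul_star_self_of_mem hA.eigenvectorUnitary.2
  generalize (hA.eigenvectorUnitary : Matrix (Fin m) (Fin m) ℝ) = U at hsp hU
  rw [Matrix.star_eq_conjTranspose, Matrix.conjTranspose_eq_transpose_of_trivial U] at hsp hU
  have hMM : M * Mᵀ = M * Mᴴ := by rw [Matrix.conjTranspose_eq_transpose_of_trivial]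
  replace hsp := hMM.trans hsp
  have key : ∀ {p q : ℕ} (B : Matrix (Fin p) (Fin q) ℝ) (v : Fin q → ℝ),
      ∑ i, (B *ᵥ v) i ^ 2 = v ⬝ᵥ ((Bᵀ * B) *ᵥ v) := by
    intro p q B v
    rw [← Matrix.mulVec_mulVec, Matrix.dotProduct_mulVec, Matrix.vecMul_transpose]
    simp [dotProduct, sq]
  refine ⟨Uᵀ, fun v => ?_, fun v => ?_⟩
  · rw [key, Matrix.transpose_transpose, hU, Matrix.one_mulVec]
    simp [dotProduct, sq]
  · rw [key, Matrix.transpose_transpose, hsp, ← Matrix.mulVec_mulVec, ← Matrix.mulVec_mulVec,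
      Matrix.dotProduct_mulVec, ← Matrix.mulVec_transpose]
    simp only [dotProduct, Matrix.mulVec_diagonal]
    refine Finset.sum_congr rfl fun i _ => ?_
    simp
    ring

theorem aux_main {m n K : ℕ} (M : Matrix (Fin m) (Fin n) ℝ) (D : Matrix (Fin m) (Fin K) ℝ)
    (hD : ∀ x, D *ᵥ x = 0 → x = 0) (hK : 1 ≤ K) (hKm : K ≤ m) (c : ℝ)
    (hc : ∀ x, c * ∑ i, (D *ᵥ x) i ^ 2 ≤ ∑ j, (Mᵀ *ᵥ (D *ᵥ x)) j ^ 2) :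
    c ≤ kthEigMulSelf M K := by
  unfold kthEigMulSelf
  refine aux_kth_ge _ _ _ hK hKm ?_
  obtain ⟨Q, h1, h2⟩ := aux_spec M
  generalize (Matrix.isHermitian_mul_conjTranspose_self M).eigenvalues = f at *
  by_contra hlt
  push Not at hlt
  let T : (Fin K → ℝ) →ₗ[ℝ] ({i // c ≤ f i} → ℝ) :=
    (LinearMap.funLeft ℝ ℝ Subtype.val) ∘ₗ (Q * D).mulVecLin
  have hT : LinearMap.ker T ≠ ⊥ := by
    apply LinearMap.ker_ne_bot_of_finrank_lt
    simp only [Module.finrank_fintype_fun_eq_card, Fintype.card_fin, Fintype.card_subtype]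
    exact hlt
  obtain ⟨x, hx, hx0⟩ := (Submodule.ne_bot_iff _).1 hT
  apply hx0
  apply hD
  have hq : ∀ i, c ≤ f i → (Q *ᵥ (D *ᵥ x)) i = 0 := by
    intro i hi
    have := congrFun (LinearMap.mem_ker.1 hx) ⟨i, hi⟩
    simpa [T, LinearMap.funLeft_apply, Matrix.mulVec_mulVec] using this
  have h3 := hc x
  rw [h2, ← h1, Finset.mul_sum] at h3
  have h4 : ∀ i ∈ Finset.univ, 0 ≤ (c - f i) * (Q *ᵥ (D *ᵥ x)) i ^ 2 := by
    intro i _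
    rcases le_or_gt c (f i) with h | h
    · simp [hq i h]
    · exact mul_nonneg (by linarith) (sq_nonneg _)
  have h5 : ∑ i, (c - f i) * (Q *ᵥ (D *ᵥ x)) i ^ 2 = 0 := by
    apply le_antisymm _ (Finset.sum_nonneg h4)
    simp only [sub_mul, Finset.sum_sub_distrib]
    linarith
  have h6 := (Finset.sum_eq_zero_iff_of_nonneg h4).1 h5
  have h7 : ∀ i, (Q *ᵥ (D *ᵥ x)) i = 0 := by
    intro i
    rcases le_or_gt c (f i) with h | h
    · exact hq i h
    · have := h6 i (Finset.mem_univ _)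
      rcases mul_eq_zero.1 this with h' | h'
      · linarith
      · exact pow_eq_zero_iff (two_ne_zero) |>.1 h'
  have h8 := h1 (D *ᵥ x)
  simp only [h7] at h8
  have h9 := (Finset.sum_eq_zero_iff_of_nonneg (fun i _ => sq_nonneg ((D *ᵥ x) i))).1
    (by simpa using h8.symm)
  funext i
  exact pow_eq_zero_iff (two_ne_zero) |>.1 (h9 i (Finset.mem_univ _))

theorem aux_P {m n : ℕ} (M : Matrix (Fin m) (Fin n) ℝ) (hm : 0 < m) (y : Fin m → ℝ) :
    kthSingular M m ^ 2 * ∑ i, y i ^ 2 ≤ ∑ j, (Mᵀ *ᵥ y) j ^ 2 := by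
  have hnn : 0 ≤ kthEigMulSelf M m := by
    unfold kthEigMulSelf
    obtain ⟨i, hi⟩ := aux_kth_mem (Matrix.isHermitian_mul_conjTranspose_self M).eigenvalues hm
    rw [hi]
    exact (Matrix.posSemidef_self_mul_conjTranspose M).eigenvalues_nonneg i
  unfold kthSingular
  rw [Real.sq_sqrt hnn]
  obtain ⟨Q, h1, h2⟩ := aux_spec M
  rw [h2, ← h1, Finset.mul_sum]
  exact Finset.sum_le_sum fun i _ => mul_le_mul_of_nonneg_right (aux_kth_le _ i) (sq_nonneg _)

theorem aux_D {n K : ℕ} (g : Fin n → Fin K) (θ : Fin n → ℝ) (x : Fin K → ℝ) (i : Fin n) :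
    ((Matrix.diagonal θ * memMat g) *ᵥ x) i = θ i * x (g i) := by
  rw [← Matrix.mulVec_mulVec, Matrix.mulVec_diagonal]
  simp [Matrix.mulVec, dotProduct, memMat]

theorem aux_DT {n K : ℕ} (g : Fin n → Fin K) (θ : Fin n → ℝ) (v : Fin n → ℝ) (k : Fin K) :
    ((Matrix.diagonal θ * memMat g)ᵀ *ᵥ v) k = ∑ i with g i = k, θ i * v i := by
  simp only [Matrix.mulVec, dotProduct, Matrix.transpose_apply, Matrix.diagonal_mul, memMat,
    Finset.sum_filter]
  refine Finset.sum_congr rfl fun i _ => ?_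
  split_ifs <;> simp

theorem aux_fib {n K : ℕ} (g : Fin n → Fin K) (θ : Fin n → ℝ) (x : Fin K → ℝ) :
    ∑ i, (θ i * x (g i)) ^ 2 = ∑ k, (∑ i with g i = k, θ i ^ 2) * x k ^ 2 := by
  rw [← Finset.sum_fiberwise Finset.univ g]
  refine Finset.sum_congr rfl fun k _ => ?_
  rw [Finset.sum_mul]
  refine Finset.sum_congr rfl fun i hi => ?_
  rw [(Finset.mem_filter.1 hi).2]; ring

theorem aux_min {n K : ℕ} (g : Fin n → Fin K) (θ : Fin n → ℝ) (hθ : ∀ i, 0 < θ i) (k : Fin K) :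
    (⨅ i, θ i) ^ 2 * (minClusterSize g : ℝ) ≤ ∑ i with g i = k, θ i ^ 2 := by
  have h0 : 0 ≤ ⨅ i, θ i := Real.iInf_nonneg fun i => (hθ i).le
  have h1 : (minClusterSize g : ℝ) ≤ (clusterSize g k : ℝ) := by
    have : minClusterSize g ≤ clusterSize g k := Nat.sInf_le (Set.mem_range_self k)
    exact_mod_cast this
  calc (⨅ i, θ i) ^ 2 * (minClusterSize g : ℝ) ≤ (⨅ i, θ i) ^ 2 * (clusterSize g k : ℝ) :=
        mul_le_mul_of_nonneg_left h1 (sq_nonneg _)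
    _ = ∑ i with g i = k, (⨅ i, θ i) ^ 2 := by
        rw [Finset.sum_const, nsmul_eq_mul, mul_comm]; rfl
    _ ≤ _ := Finset.sum_le_sum fun i _ =>
        pow_le_pow_left₀ h0 (ciInf_le (Set.finite_range θ).bddBelow i) 2

/-- Under `BiDCDFM(Z_r, Z_c, P, Θ_r, Θ_c)`, the `K_r`-th largest
eigenvalue of `Ω Ωᵀ` satisfies
`λ_{K_r}(Ω Ωᵀ) ≥ θ²_{r,min} θ²_{c,min} σ_{K_r}²(P) n_{r,min} n_{c,min}`. -/
theorem stmt_14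
    {nr nc Kr Kc : ℕ} (hK : Kr ≤ Kc)
    (gr : Fin nr → Fin Kr) (gc : Fin nc → Fin Kc)
    (hgr : Function.Surjective gr) (hgc : Function.Surjective gc)
    (P : Matrix (Fin Kr) (Fin Kc) ℝ) (hPrank : P.rank = Kr)
    (hPle : ∀ k l, |P k l| ≤ 1) (hPmax : ∃ k l, |P k l| = 1)
    (θr : Fin nr → ℝ) (θc : Fin nc → ℝ)
    (hθr : ∀ i, 0 < θr i) (hθc : ∀ j, 0 < θc j)
    (Ω : Matrix (Fin nr) (Fin nc) ℝ)
    (hΩ : Ω = Matrix.diagonal θr * memMat gr * P * (memMat gc)ᵀ * Matrix.diagonal θc)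
    (θrmin θcmin : ℝ) (hθrmin : θrmin = ⨅ i, θr i) (hθcmin : θcmin = ⨅ j, θc j) :
    kthEigMulSelf Ω Kr ≥
      θrmin ^ 2 * θcmin ^ 2 * (kthSingular P Kr) ^ 2 *
        (minClusterSize gr : ℝ) * (minClusterSize gc : ℝ) := by
  have hKr : 1 ≤ Kr := by
    obtain ⟨k, _⟩ := hPmax
    have := k.2
    omega
  have hKn : Kr ≤ nr := by
    simpa using Fintype.card_le_of_surjective gr hgr
  set a := θrmin ^ 2 * (minClusterSize gr : ℝ) with ha
  set b := θcmin ^ 2 * (minClusterSize gc : ℝ) with hb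
  have ha0 : 0 ≤ a := by positivity
  have hb0 : 0 ≤ b := by positivity
  have hag : ∀ k, a ≤ ∑ i with gr i = k, θr i ^ 2 := by
    intro k; rw [ha, hθrmin]; exact aux_min gr θr hθr k
  have hbg : ∀ k, b ≤ ∑ i with gc i = k, θc i ^ 2 := by
    intro k; rw [hb, hθcmin]; exact aux_min gc θc hθc k
  have hgoal : θrmin ^ 2 * θcmin ^ 2 * (kthSingular P Kr) ^ 2 *
        (minClusterSize gr : ℝ) * (minClusterSize gc : ℝ) = b * (kthSingular P Kr ^ 2 * a) := by
    rw [ha, hb]; ring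
  rw [ge_iff_le, hgoal]
  refine aux_main Ω (Matrix.diagonal θr * memMat gr) ?_ hKr hKn _ ?_
  · intro x hx
    funext k
    obtain ⟨i, rfl⟩ := hgr k
    have := congrFun hx i
    rw [aux_D] at this
    exact (mul_eq_zero.1 this).resolve_left (hθr i).ne'
  · intro x
    have hT : Ωᵀ = (Matrix.diagonal θc * memMat gc) * (Pᵀ * (Matrix.diagonal θr * memMat gr)ᵀ) := by
      rw [hΩ]
      simp only [Matrix.transpose_mul, Matrix.transpose_transpose, Matrix.diagonal_transpose,
        Matrix.mul_assoc]
    have hTv : Ωᵀ *ᵥ ((Matrix.diagonal θr * memMat gr) *ᵥ x) =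
        (Matrix.diagonal θc * memMat gc) *ᵥ (Pᵀ *ᵥ ((Matrix.diagonal θr * memMat gr)ᵀ *ᵥ
          ((Matrix.diagonal θr * memMat gr) *ᵥ x))) := by
      rw [hT]
      simp only [Matrix.mulVec_mulVec, Matrix.mul_assoc]
    rw [hTv]
    set y := (Matrix.diagonal θr * memMat gr)ᵀ *ᵥ ((Matrix.diagonal θr * memMat gr) *ᵥ x) with hy
    have hyk : ∀ k, y k = (∑ i with gr i = k, θr i ^ 2) * x k := by
      intro k
      rw [hy, aux_DT, Finset.sum_mul]
      refine Finset.sum_congr rfl fun i hi => ?_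
      rw [aux_D, (Finset.mem_filter.1 hi).2]; ring
    have e1 : a * ∑ i, ((Matrix.diagonal θr * memMat gr) *ᵥ x) i ^ 2 ≤ ∑ k, y k ^ 2 := by
      simp only [hyk]
      simp only [aux_D]
      rw [aux_fib]
      rw [Finset.mul_sum]
      refine Finset.sum_le_sum fun k _ => ?_
      have h1 := hag k
      have h2 := mul_le_mul_of_nonneg_right h1
        (mul_nonneg (ha0.trans h1) (sq_nonneg (x k)))
      calc _ ≤ _ := h2
        _ = _ := by ring
    have e2 := aux_P P hKr y
    have e3 : b * ∑ j, (Pᵀ *ᵥ y) j ^ 2 ≤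
        ∑ j, ((Matrix.diagonal θc * memMat gc) *ᵥ (Pᵀ *ᵥ y)) j ^ 2 := by
      simp only [aux_D, aux_fib]
      rw [Finset.mul_sum]
      exact Finset.sum_le_sum fun k _ => mul_le_mul_of_nonneg_right (hbg k) (sq_nonneg _)
    refine le_trans ?_ e3
    rw [mul_assoc]
    refine mul_le_mul_of_nonneg_left (le_trans ?_ e2) hb0
    rw [mul_assoc]
    exact mul_le_mul_of_nonneg_left e1 (sq_nonneg _)
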